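/- arXiv:math/9307217 — 7 statements merged into one kernel-verified Lean document; each statement's English description precedes it below -/
import Mathlib

section
/- Let α, c be complex numbers such that 1+α is not a nonpositive integer and c is not a nonpositive integer. For each integer n ≥ 0 define u_n(x) = ((c+α+1)_n/(c+1)_n) · ₁F₁(−n−c; 1+α; x). Then for every integer n ≥ 1 and every complex x, (2n+2c+α+1−x) u_n(x) = (n+c+1) u_{n+1}(x) + (n+c+α) u_{n−1}(x). -/
/-- Pochhammer symbol `(a)_k` for complex `a`. -/
noncomputable def pochC (a : ℂ) (k : ℕ) : ℂ := (ascPochhammer ℂ k).eval a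

/-- Confluent hypergeometric series `₁F₁(a; b; x)`. -/
noncomputable def hyp1F1 (a b x : ℂ) : ℂ :=
  ∑' k : ℕ, pochC a k * x ^ k / (pochC b k * (Nat.factorial k : ℂ))

/-- The solution `u_n` of the associated Laguerre recurrence. -/
noncomputable def uLag (α c : ℂ) (n : ℕ) (x : ℂ) : ℂ :=
  (pochC (c + α + 1) n / pochC (c + 1) n) * hyp1F1 (-(n : ℂ) - c) (1 + α) x

lemma pochC_zero' (a : ℂ) : pochC a 0 = 1 := by simp [pochC]

lemma pochC_succ' (a : ℂ) (k : ℕ) : pochC a (k + 1) = pochC a k * (a + k) := by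
  simp [pochC, ascPochhammer_succ_right, Polynomial.eval_mul]

lemma pochC_left (a : ℂ) (k : ℕ) : pochC a (k + 1) = a * pochC (a + 1) k := by
  induction k with
  | zero => simp [pochC_succ', pochC_zero']
  | succ m ih => rw [pochC_succ', ih, pochC_succ' (a + 1) m]; push_cast; ring

lemma pochC_ne (b : ℂ) (hb : ∀ k : ℕ, b ≠ -(k : ℂ)) (k : ℕ) : pochC b k ≠ 0 := by
  induction k with
  | zero => simp [pochC_zero']
  | succ m ih =>
    rw [pochC_succ']
    exact mul_ne_zero ih fun h => hb m (eq_neg_of_add_eq_zero_left h)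

noncomputable def trm (a b x : ℂ) (k : ℕ) : ℂ :=
  pochC a k * x ^ k / (pochC b k * (Nat.factorial k : ℂ))

lemma trm_succ (a b x : ℂ) (k : ℕ) :
    trm a b x (k + 1) = ((a + 1 * k) / (b + 1 * k) * (x / (0 + 1 * k + 1))) * trm a b x k := by
  simp only [trm, pochC_succ', Nat.factorial_succ, div_eq_mul_inv, mul_inv, pow_succ]
  push_cast
  simp only [mul_inv, one_mul, zero_add]
  ring

lemma trm_summable (a b x : ℂ) : Summable (trm a b x) := by
  have h1 := tendsto_add_mul_div_add_mul_atTop_nhds (𝕜 := ℂ) a b 1 one_ne_zero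
  have h2 := tendsto_add_mul_div_add_mul_atTop_nhds (𝕜 := ℂ) x 1 0 one_ne_zero
  have h3 := (h1.mul h2).norm
  simp only [div_one, mul_zero, norm_zero] at h3
  refine summable_of_ratio_norm_eventually_le (r := 1 / 2) (by norm_num) ?_
  filter_upwards [h3.eventually_le_const (show (0 : ℝ) < 1 / 2 by norm_num)] with k hk
  rw [trm_succ, norm_mul]
  refine mul_le_mul_of_nonneg_right ?_ (norm_nonneg _)
  have e : (x + 0 * (k : ℂ)) / (1 + 1 * k) = x / (0 + 1 * k + 1) := by
    congr 1 <;> ring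
  rw [← e]
  exact hk

lemma contig (a b x : ℂ) (hb : ∀ k : ℕ, b ≠ -(k : ℂ)) :
    (b - 2 * a - x) * hyp1F1 a b x
      = (b - a) * hyp1F1 (a - 1) b x - a * hyp1F1 (a + 1) b x := by
  have e : ∀ a, hyp1F1 a b x = 1 + ∑' k, trm a b x (k + 1) := by
    intro a
    have h := (trm_summable a b x).tsum_eq_zero_add
    have h0 : trm a b x 0 = 1 := by simp [trm, pochC_zero']
    rw [h0] at h
    exact h
  have s : ∀ a, Summable fun k => trm a b x (k + 1) := fun a =>
    (summable_nat_add_iff 1).2 (trm_summable a b x)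
  have key : ∀ k, (b - 2 * a) * trm a b x (k + 1) - x * trm a b x k
      = (b - a) * trm (a - 1) b x (k + 1) - a * trm (a + 1) b x (k + 1) := by
    intro k
    have hb1 := pochC_ne b hb k
    have hb2 : b + k ≠ 0 := fun h => hb k (eq_neg_of_add_eq_zero_left h)
    have hk : (k : ℂ) + 1 ≠ 0 := Nat.cast_add_one_ne_zero k
    have hf : (Nat.factorial k : ℂ) ≠ 0 := by exact_mod_cast Nat.factorial_ne_zero k
    have p1 : pochC (a - 1) (k + 1) = (a - 1) * pochC a k := by
      rw [pochC_left]; simp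
    have p2 : a * pochC (a + 1) (k + 1) = pochC a k * (a + k) * (a + k + 1) := by
      rw [← pochC_left, pochC_succ', pochC_succ']; push_cast; ring
    have p3 : a * trm (a + 1) b x (k + 1) = pochC a k * (a + k) * (a + k + 1) * x ^ (k + 1)
        / (pochC b (k + 1) * (Nat.factorial (k + 1) : ℂ)) := by
      rw [← p2, trm]; ring
    rw [p3]
    simp only [trm, p1, pochC_succ', Nat.factorial_succ]
    push_cast
    field_simp
    ring
  have hs := tsum_congr (L := SummationFilter.unconditional ℕ) key
  rw [((s a).mul_left _).tsum_sub ((trm_summable a b x).mul_left _),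
    ((s _).mul_left _).tsum_sub ((s _).mul_left _)] at hs
  simp only [tsum_mul_left] at hs
  have e0 : ∑' k, trm a b x k = hyp1F1 a b x := rfl
  rw [e0] at hs
  rw [e (a - 1), e (a + 1)]
  have ea := e a
  linear_combination hs + (b - 2 * a) * ea

theorem stmt0 (α c : ℂ)
    (hα : ∀ k : ℕ, 1 + α ≠ -(k : ℂ))
    (hc : ∀ k : ℕ, c ≠ -(k : ℂ)) :
    ∀ n : ℕ, 1 ≤ n → ∀ x : ℂ,
      (2 * (n : ℂ) + 2 * c + α + 1 - x) * uLag α c n x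
        = ((n : ℂ) + c + 1) * uLag α c (n + 1) x
          + ((n : ℂ) + c + α) * uLag α c (n - 1) x := by
  intro n hn x
  obtain ⟨m, rfl⟩ : ∃ m, n = m + 1 := ⟨n - 1, by omega⟩
  have hc1 : ∀ k : ℕ, c + 1 ≠ -(k : ℂ) := fun k h =>
    hc (k + 1) (by push_cast; linear_combination h)
  have q := pochC_ne (c + 1) hc1 m
  have q1 : c + 1 + m ≠ 0 := fun h => hc1 m (eq_neg_of_add_eq_zero_left h)
  have q2 : c + 1 + (m + 1) ≠ 0 := fun h =>
    hc1 (m + 1) (by push_cast; exact eq_neg_of_add_eq_zero_left h)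
  have h := contig (-((m + 1 : ℕ) : ℂ) - c) (1 + α) x hα
  have a1 : -((m + 1 : ℕ) : ℂ) - c - 1 = -((m + 1 + 1 : ℕ) : ℂ) - c := by push_cast; ring
  have a2 : -((m + 1 : ℕ) : ℂ) - c + 1 = -((m : ℕ) : ℂ) - c := by push_cast; ring
  rw [a1, a2] at h
  simp only [uLag, Nat.add_sub_cancel]
  generalize hyp1F1 (-((m + 1 : ℕ) : ℂ) - c) (1 + α) x = A at *
  generalize hyp1F1 (-((m + 1 + 1 : ℕ) : ℂ) - c) (1 + α) x = B at *
  generalize hyp1F1 (-(m : ℂ) - c) (1 + α) x = C at *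
  simp only [pochC_succ']
  push_cast at h ⊢
  field_simp
  linear_combination (c + α + 1 + m) * (c + 1 + (m + 1)) * pochC (c + α + 1) m * h
end

section
/- Let α, c, μ be real numbers with μ ≠ 0, c+α ≠ 0, c and c+α not nonpositive integers, and set G = c(c+α)/μ, assuming G is not a nonpositive integer. Let L_n^α(x; c, μ) be the co-recursive associated Laguerre polynomials. Then for every n ≥ 0 and every x, L_n^α(x; c, μ) = ((c+α+1)_n / n!) · ∑_{k=0}^n [ (−n)_k / ((c+1)_k (c+α+1)_k) ] · ( ∑_{j=0}^{n−k} [ (k−n)_j (c)_j (c+α)_j (G+1)_j ] / [ (c+k+1)_j (c+α+k+1)_j (G)_j j! ] ) · x^k. -/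
/-- Pochhammer symbol `(a)_k` for real `a`. -/
noncomputable def pochR (a : ℝ) (k : ℕ) : ℝ := (ascPochhammer ℝ k).eval a

lemma pochR_zero (a : ℝ) : pochR a 0 = 1 := by simp [pochR]

lemma pochR_succ (a : ℝ) (k : ℕ) : pochR a (k + 1) = pochR a k * (a + k) := by
  simp [pochR, ascPochhammer_succ_eval]

lemma pochR_shift (a : ℝ) (k : ℕ) : pochR a k * (a + k) = a * pochR (a + 1) k := by
  induction k with
  | zero => simp [pochR_zero]
  | succ k ih =>
    rw [pochR_succ, pochR_succ, ih]
    push_cast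
    ring

lemma pochR_add (a : ℝ) (k j : ℕ) : pochR a (k + j) = pochR a k * pochR (a + k) j := by
  induction j with
  | zero => simp [pochR_zero]
  | succ j ih =>
    rw [← add_assoc, pochR_succ, pochR_succ, ih]
    push_cast
    ring

lemma pochR_ne (a : ℝ) (h : ∀ k : ℕ, a ≠ -(k : ℝ)) (k : ℕ) : pochR a k ≠ 0 := by
  induction k with
  | zero => simp [pochR_zero]
  | succ k ih =>
    rw [pochR_succ]
    exact mul_ne_zero ih (fun h0 => h k (by linarith))

lemma choose_step (n k : ℕ) :
    ((k : ℝ) + 1) * (n.choose (k + 1) : ℝ) = ((n : ℝ) - k) * (n.choose k : ℝ) := by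
  rcases le_or_gt k n with h | h
  · have := Nat.choose_succ_right_eq n k
    have h2 : (n.choose (k + 1) : ℝ) * ((k : ℝ) + 1) = (n.choose k : ℝ) * ((n - k : ℕ) : ℝ) := by
      exact_mod_cast this
    rw [Nat.cast_sub h] at h2
    linarith
  · rw [Nat.choose_eq_zero_of_lt h, Nat.choose_eq_zero_of_lt (by omega)]
    simp

lemma choose_up (n k : ℕ) :
    ((n : ℝ) + 1) * (n.choose k : ℝ) = ((n : ℝ) + 1 - k) * ((n + 1).choose k : ℝ) := by
  cases k with
  | zero => simp
  | succ k =>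
    have h1 := choose_step n k
    rw [Nat.choose_succ_succ]
    push_cast
    linarith

lemma choose_diag (n k : ℕ) :
    ((n : ℝ) + 1) * (n.choose k : ℝ) = ((n + 1).choose (k + 1) : ℝ) * ((k : ℝ) + 1) := by
  exact_mod_cast Nat.add_one_mul_choose_eq n k

lemma pochR_neg (n m : ℕ) :
    pochR (-(n : ℝ)) m = (-1) ^ m * (m.factorial : ℝ) * (n.choose m : ℝ) := by
  induction m with
  | zero => simp [pochR_zero]
  | succ m ih =>
    rw [pochR_succ, ih, Nat.factorial_succ]
    have := choose_step n m
    push_cast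
    linear_combination ((-1 : ℝ) ^ m * (m.factorial : ℝ)) * this

lemma alt_zero (N : ℕ) :
    ∑ m ∈ Finset.range (N + 2), ((N + 1).choose m : ℝ) * (-1) ^ m = 0 := by
  have h := Int.alternating_sum_range_choose_of_ne (n := N + 1) (by omega)
  have h2 : ((∑ m ∈ Finset.range (N + 1 + 1), ((-1 : ℤ) ^ m * ((N + 1).choose m : ℤ)) : ℤ) : ℝ)
      = 0 := by
    rw [h]; simp
  push_cast at h2
  rw [← h2]
  exact Finset.sum_congr rfl fun m _ => mul_comm _ _

lemma alt_one (N : ℕ) :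
    ∑ m ∈ Finset.range (N + 3), ((N + 2).choose m : ℝ) * ((-1) ^ m * (m : ℝ)) = 0 := by
  rw [Finset.sum_range_succ']
  have : ∀ m ∈ Finset.range (N + 2),
      ((N + 2).choose (m + 1) : ℝ) * ((-1) ^ (m + 1) * ((m + 1 : ℕ) : ℝ))
        = (-((N : ℝ) + 2)) * (((N + 1).choose m : ℝ) * (-1) ^ m) := by
    intro m _
    have h := choose_diag (N + 1) m
    push_cast at h ⊢
    rw [pow_succ]
    linear_combination (-(-1 : ℝ) ^ m) * h.symm
  rw [Finset.sum_congr rfl this, ← Finset.mul_sum, alt_zero]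
  simp

/-- extend the range of a binomial sum -/
lemma ext_sum (n r : ℕ) (f : ℕ → ℝ) :
    ∑ m ∈ Finset.range (n + 1), (n.choose m : ℝ) * f m
      = ∑ m ∈ Finset.range (n + 1 + r), (n.choose m : ℝ) * f m := by
  apply Finset.sum_subset
  · intro m; simp only [Finset.mem_range]; omega
  · intro m _ h
    rw [Nat.choose_eq_zero_of_lt (by simpa using h)]
    simp

noncomputable def bb (b : ℕ → ℝ) (x : ℝ) (m : ℕ) : ℝ :=
  ∑ k ∈ Finset.range (m + 1), b (m - k) * x ^ k

lemma bb_succ (b : ℕ → ℝ) (x : ℝ) (m : ℕ) : bb b x (m + 1) = x * bb b x m + b (m + 1) := by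
  unfold bb
  rw [Finset.sum_range_succ', Finset.mul_sum]
  congr 1
  · apply Finset.sum_congr rfl
    intro k _
    rw [Nat.add_sub_add_right, pow_succ]; ring
  · simp

noncomputable def pp (u b : ℕ → ℝ) (x : ℝ) (n : ℕ) : ℝ :=
  ∑ m ∈ Finset.range (n + 1), (n.choose m : ℝ) * (u m * bb b x m)

lemma pp_rec (c β μ x : ℝ) (u b : ℕ → ℝ)
    (hu : ∀ m : ℕ, ((m : ℝ) + 1) * u m = -((c + (m + 1)) * (β + (m + 1))) * u (m + 1))
    (hub : ∀ m : ℕ, (c + m) * (β + m) * u m * b m = (-1) ^ m * (c * β + m * μ)) (n : ℕ) :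
    ((n : ℝ) + 2) * (2 * ((n : ℝ) + 1) + c + β + 1 - x) * pp u b x (n + 1)
      = ((n : ℝ) + 1 + c + 1) * ((n : ℝ) + 1 + β + 1) * pp u b x (n + 2)
        + ((n : ℝ) + 1) * ((n : ℝ) + 2) * pp u b x n := by
  have hx : ((n : ℝ) + 2) * (x * pp u b x (n + 1))
      = ∑ m ∈ Finset.range (n + 3), ((n + 2).choose m : ℝ) *
          (-((c + m) * (β + m)) * u m * (bb b x m - b m)) := by
    rw [Finset.sum_range_succ']
    unfold pp
    rw [Finset.mul_sum, Finset.mul_sum]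
    have h0 : bb b x 0 - b 0 = 0 := by simp [bb]
    rw [h0, mul_zero, mul_zero, add_zero]
    apply Finset.sum_congr rfl
    intro m _
    have h := choose_diag (n + 1) m
    have h1 := hu m
    rw [bb_succ]
    push_cast at h ⊢
    linear_combination (x * u m * bb b x m) * h +
      (((n + 2).choose (m + 1) : ℝ) * x * bb b x m) * h1
  have hz : ∑ m ∈ Finset.range (n + 3), ((n + 2).choose m : ℝ) *
          ((c + m) * (β + m) * u m * b m) = 0 := by
    have h1 := alt_zero (n + 1)
    have h2 := alt_one n
    have : ∀ m ∈ Finset.range (n + 3), ((n + 2).choose m : ℝ) * ((c + m) * (β + m) * u m * b m)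
        = c * β * (((n + 2).choose m : ℝ) * (-1) ^ m)
          + μ * (((n + 2).choose m : ℝ) * ((-1) ^ m * (m : ℝ))) := by
      intro m _
      rw [hub]; ring
    rw [Finset.sum_congr rfl this, Finset.sum_add_distrib, ← Finset.mul_sum, ← Finset.mul_sum,
      h2, h1]
    simp
  have e1 : pp u b x (n + 1)
      = ∑ m ∈ Finset.range (n + 3), ((n + 1).choose m : ℝ) * (u m * bb b x m) :=
    ext_sum (n + 1) 1 _
  have e0 : pp u b x n = ∑ m ∈ Finset.range (n + 3), (n.choose m : ℝ) * (u m * bb b x m) :=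
    ext_sum n 2 _
  have e2 : pp u b x (n + 2)
      = ∑ m ∈ Finset.range (n + 3), ((n + 2).choose m : ℝ) * (u m * bb b x m) := rfl
  have key : ((n : ℝ) + 2) * (2 * ((n : ℝ) + 1) + c + β + 1) * pp u b x (n + 1)
      - ∑ m ∈ Finset.range (n + 3), ((n + 2).choose m : ℝ) *
          (-((c + m) * (β + m)) * u m * (bb b x m - b m))
      + ∑ m ∈ Finset.range (n + 3), ((n + 2).choose m : ℝ) *
          ((c + m) * (β + m) * u m * b m)
      - ((n : ℝ) + 1 + c + 1) * ((n : ℝ) + 1 + β + 1) * pp u b x (n + 2)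
      - ((n : ℝ) + 1) * ((n : ℝ) + 2) * pp u b x n = 0 := by
    rw [e0, e1, e2]
    simp only [Finset.mul_sum]
    rw [← Finset.sum_sub_distrib, ← Finset.sum_add_distrib, ← Finset.sum_sub_distrib,
      ← Finset.sum_sub_distrib]
    apply Finset.sum_eq_zero
    intro m _
    have h1 := choose_up (n + 1) m
    have h0 := choose_up n m
    push_cast at h1 h0
    linear_combination ((2 * ((n : ℝ) + 1) + c + β + 1) * (u m * bb b x m)
      - ((n : ℝ) + 1 - m) * (u m * bb b x m)) * h1
      - ((n : ℝ) + 2) * (u m * bb b x m) * h0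
  linear_combination key - hx - hz

theorem stmt4 (α c μ : ℝ) (hμ : μ ≠ 0) (hca : c + α ≠ 0)
    (hc : ∀ k : ℕ, c ≠ -(k : ℝ))
    (hcα : ∀ k : ℕ, c + α ≠ -(k : ℝ))
    (hG : ∀ k : ℕ, c * (c + α) / μ ≠ -(k : ℝ))
    (L : ℤ → ℝ → ℝ)
    (hinitm : ∀ x : ℝ, L (-1) x = μ / (c + α))
    (hinit0 : ∀ x : ℝ, L 0 x = 1)
    (hrec : ∀ n : ℕ, ∀ x : ℝ,
      (2 * (n : ℝ) + 2 * c + α + 1 - x) * L (n : ℤ) x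
        = ((n : ℝ) + c + 1) * L ((n : ℤ) + 1) x + ((n : ℝ) + c + α) * L ((n : ℤ) - 1) x) :
    ∀ n : ℕ, ∀ x : ℝ,
      L (n : ℤ) x = pochR (c + α + 1) n / (Nat.factorial n : ℝ) *
        ∑ k ∈ Finset.range (n + 1),
          pochR (-(n : ℝ)) k / (pochR (c + 1) k * pochR (c + α + 1) k) *
            (∑ j ∈ Finset.range (n - k + 1),
              pochR ((k : ℝ) - (n : ℝ)) j * pochR c j * pochR (c + α) j *
                  pochR (c * (c + α) / μ + 1) j /
                (pochR (c + (k : ℝ) + 1) j * pochR (c + α + (k : ℝ) + 1) j *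
                  pochR (c * (c + α) / μ) j * (Nat.factorial j : ℝ))) *
            x ^ k := by
  have hc1 : ∀ k : ℕ, c + 1 ≠ -(k : ℝ) := fun k h => hc (k + 1) (by push_cast; linarith)
  have hb1 : ∀ k : ℕ, c + α + 1 ≠ -(k : ℝ) := fun k h => hcα (k + 1) (by push_cast; linarith)
  have hc0 : c ≠ 0 := by simpa using hc 0
  set G := c * (c + α) / μ with hGdef
  have hG0 : G ≠ 0 := by simpa using hG 0
  have hGμ : G * μ = c * (c + α) := by rw [hGdef]; field_simp
  let u : ℕ → ℝ := fun m =>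
    (-1) ^ m * (m.factorial : ℝ) / (pochR (c + 1) m * pochR (c + α + 1) m)
  let b : ℕ → ℝ := fun j =>
    pochR c j * pochR (c + α) j * pochR (G + 1) j / (pochR G j * (j.factorial : ℝ))
  have hu : ∀ m : ℕ, ((m : ℝ) + 1) * u m
      = -((c + (m + 1)) * (c + α + (m + 1))) * u (m + 1) := by
    intro m
    have h1 := pochR_ne _ hc1 m
    have h2 := pochR_ne _ hb1 m
    have h3 : c + 1 + m ≠ 0 := fun h => hc1 m (by linarith)
    have h4 : c + α + 1 + m ≠ 0 := fun h => hb1 m (by linarith)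
    simp only [u]
    rw [pochR_succ, pochR_succ, Nat.factorial_succ, pow_succ]
    push_cast
    field_simp
    ring
  have hub : ∀ m : ℕ, (c + m) * (c + α + m) * u m * b m
      = (-1) ^ m * (c * (c + α) + m * μ) := by
    intro m
    have h1 := pochR_ne _ hc1 m
    have h2 := pochR_ne _ hb1 m
    have h3 := pochR_ne _ hG m
    have h4 : (m.factorial : ℝ) ≠ 0 := by exact_mod_cast m.factorial_ne_zero
    have s1 := pochR_shift c m
    have s2 := pochR_shift (c + α) m
    have s3 := pochR_shift G m
    have e1 : pochR c m * (c + m) / pochR (c + 1) m = c := by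
      rw [s1]; field_simp
    have e2 : pochR (c + α) m * (c + α + m) / pochR (c + α + 1) m = c + α := by
      rw [s2]; field_simp
    have e3 : pochR (G + 1) m / pochR G m = (G + m) / G := by
      rw [div_eq_div_iff h3 hG0]; linarith
    have e4 : (c + m) * (c + α + m) * u m * b m = (-1) ^ m *
        (pochR c m * (c + m) / pochR (c + 1) m) *
        (pochR (c + α) m * (c + α + m) / pochR (c + α + 1) m) *
        (pochR (G + 1) m / pochR G m) := by
      simp only [u, b]
      field_simp
    rw [e4, e1, e2, e3]
    have e5 : c * (c + α) * ((G + m) / G) = c * (c + α) + m * μ := by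
      rw [← hGμ]; field_simp
    linear_combination (-1 : ℝ) ^ m * e5
  have main : ∀ n : ℕ, ∀ x : ℝ,
      L (n : ℤ) x = pochR (c + α + 1) n / (n.factorial : ℝ) * pp u b x n := by
    intro n x
    have h0 : L ((0 : ℕ) : ℤ) x
        = pochR (c + α + 1) 0 / (Nat.factorial 0 : ℝ) * pp u b x 0 := by
      simp [hinit0, pochR_zero, pp, bb, u, b]
    have h1 : L ((1 : ℕ) : ℤ) x
        = pochR (c + α + 1) 1 / (Nat.factorial 1 : ℝ) * pp u b x 1 := by
      have h := hrec 0 x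
      have h3 : c + 1 ≠ 0 := by simpa using hc1 0
      have h4 : c + α + 1 ≠ 0 := by simpa using hb1 0
      have hb0 : b 0 = 1 := by simp [b, pochR_zero]
      have hu0 : u 0 = 1 := by simp [u, pochR_zero]
      have hu1 := hu 0
      have hub1 := hub 1
      rw [hu0] at hu1
      simp only [Nat.cast_zero, zero_add, mul_zero, zero_sub, hinitm] at h hu1
      rw [hinit0] at h
      have h5 : (c + α) * (μ / (c + α)) = μ := by field_simp
      have h6 : pp u b x 1 = 1 + u 1 * (x + b 1) := by
        simp [pp, bb, Finset.sum_range_succ, hb0, hu0, add_comm]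
      have h7 : pochR (c + α + 1) 1 = c + α + 1 := by
        rw [pochR_succ, pochR_zero]; simp
      rw [h6, h7]
      simp only [Nat.factorial_one, Nat.cast_one, div_one, pow_one] at hub1 ⊢
      apply mul_left_cancel₀ h3
      linear_combination -h - h5 - hub1 - x * hu1
    have step : ∀ n : ℕ,
        L (n : ℤ) x = pochR (c + α + 1) n / (n.factorial : ℝ) * pp u b x n ∧
        L ((n + 1 : ℕ) : ℤ) x
          = pochR (c + α + 1) (n + 1) / ((n + 1).factorial : ℝ) * pp u b x (n + 1) := by
      intro n
      induction n with
      | zero => exact ⟨h0, h1⟩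
      | succ n ih =>
        refine ⟨ih.2, ?_⟩
        obtain ⟨i0, i1⟩ := ih
        have h := hrec (n + 1) x
        have hr := pp_rec c (c + α) μ x u b hu hub n
        rw [show (((n + 1 : ℕ) : ℤ) - 1) = (n : ℤ) by push_cast; ring, i0, i1] at h
        rw [show (((n + 1 : ℕ) : ℤ) + 1) = ((n + 1 + 1 : ℕ) : ℤ) by push_cast; ring] at h
        have h3 : (n : ℝ) + 1 + c + 1 ≠ 0 := fun h => hc (n + 2) (by push_cast; linarith)
        apply mul_left_cancel₀ h3
        have hf : (n.factorial : ℝ) ≠ 0 := by exact_mod_cast n.factorial_ne_zero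
        have hn1 : (n : ℝ) + 1 ≠ 0 := by positivity
        have hn2 : (n : ℝ) + 1 + 1 ≠ 0 := by positivity
        rw [pochR_succ _ (n + 1)]
        rw [pochR_succ _ n] at h ⊢
        rw [Nat.factorial_succ (n + 1)]
        rw [Nat.factorial_succ n] at h ⊢
        push_cast at h ⊢
        have h' : ((n : ℝ) + 1 + c + 1) * L ((n : ℤ) + 1 + 1) x =
          (2 * ((n : ℝ) + 1) + 2 * c + α + 1 - x) * (pochR (c + α + 1) n * (c + α + 1 + n) /
            (((n : ℝ) + 1) * n.factorial) * pp u b x (n + 1))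
          - ((n : ℝ) + 1 + c + α) * (pochR (c + α + 1) n / n.factorial * pp u b x n) := by
          linear_combination -h
        rw [h']
        obtain ⟨K, hK⟩ : ∃ K : ℝ, K = pochR (c + α + 1) n * (c + α + 1 + n) /
            (((n : ℝ) + 1 + 1) * (((n : ℝ) + 1) * n.factorial)) := ⟨_, rfl⟩
        have q1 : pochR (c + α + 1) n * (c + α + 1 + n) / (((n : ℝ) + 1) * n.factorial)
            = K * ((n : ℝ) + 1 + 1) := by
          rw [hK]; field_simp
        have q0 : ((n : ℝ) + 1 + c + α) * (pochR (c + α + 1) n / n.factorial)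
            = K * (((n : ℝ) + 1) * ((n : ℝ) + 1 + 1)) := by
          rw [hK]; field_simp; ring
        have q2 : pochR (c + α + 1) n * (c + α + 1 + n) * (c + α + 1 + ((n : ℝ) + 1)) /
            (((n : ℝ) + 1 + 1) * (((n : ℝ) + 1) * n.factorial))
            = K * (c + α + 1 + ((n : ℝ) + 1)) := by
          rw [hK]; field_simp
        rw [q1, q2, ← mul_assoc ((n : ℝ) + 1 + c + α), q0]
        linear_combination K * hr
    exact (step n).1
  intro n x
  rw [main n x]
  congr 1
  unfold pp bb
  simp only [Finset.mul_sum]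
  rw [Finset.sum_comm' (t' := Finset.range (n + 1)) (s' := fun k => Finset.Ico k (n + 1))
    (by intro a d; simp only [Finset.mem_range, Finset.mem_Ico]; omega)]
  apply Finset.sum_congr rfl
  intro k hk
  have hk' : k ≤ n := by simpa [Nat.lt_succ_iff] using hk
  rw [Finset.sum_Ico_eq_sum_range, Finset.sum_mul, show n + 1 - k = n - k + 1 by omega]
  apply Finset.sum_congr rfl
  intro j _
  rw [Nat.add_sub_cancel_left]
  have a1 := pochR_add (c + 1) k j
  have a2 := pochR_add (c + α + 1) k j
  have a3 := pochR_add (-(n : ℝ)) k j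
  rw [pochR_neg n (k + j), show -(n : ℝ) + k = k - n by ring] at a3
  rw [show c + 1 + (k : ℝ) = c + k + 1 by ring] at a1
  rw [show c + α + 1 + (k : ℝ) = c + α + k + 1 by ring] at a2
  simp only [u, b]
  rw [a1, a2]
  simp only [div_eq_mul_inv, mul_inv]
  linear_combination (((pochR (c + 1) k)⁻¹ * (pochR (c + k + 1) j)⁻¹ *
    ((pochR (c + α + 1) k)⁻¹ * (pochR (c + α + k + 1) j)⁻¹)) *
    (pochR c j * pochR (c + α) j * pochR (G + 1) j * ((pochR G j)⁻¹ * (j.factorial : ℝ)⁻¹)) *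
    x ^ k) * a3
end

section
/- Let α, c, μ be real numbers with c ≥ 0, c+α > −1 and c+α ≠ 0, and let L_n^α(x; c, μ) be the co-recursive associated Laguerre polynomials. Fix a real x. Then the power series F(x,w) = ∑_{n=0}^∞ L_n^α(x; c, μ) w^n converges for all real w with |w| < 1, and on this interval F satisfies the first-order differential equation w(1−w)² ∂F/∂w + [ (1−w)(c − (c+α+1)w) + xw ] F = c − μ w. -/
theorem aux_summable (a : ℕ → ℝ) (α c x : ℝ) (hc : 0 ≤ c)
    (hr : ∀ n : ℕ, (2 * ((n : ℝ) + 1) + 2 * c + α + 1 - x) * a (n + 1)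
      = ((n : ℝ) + 1 + c + 1) * a (n + 2) + ((n : ℝ) + 1 + c + α) * a n)
    (w : ℝ) (hw0 : 0 < w) (hw : w < 1) : Summable (fun n : ℕ => |a n| * w ^ n) := by
  obtain ⟨δ, hδ, hδw⟩ : ∃ δ : ℝ, 0 < δ ∧ (1 + δ) * w < 1 := by
    refine ⟨(1 - w) / 2, by linarith, by nlinarith⟩
  obtain ⟨K, hK, hKδ⟩ : ∃ K : ℝ, 0 < K ∧ K * δ = 2 := ⟨2 / δ, by positivity, by field_simp⟩
  obtain ⟨ε, hε, h1⟩ : ∃ ε : ℝ, 0 < ε ∧ (1 + K) * ε ≤ min δ 1 := by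
    refine ⟨min δ 1 / (1 + K), by positivity, le_of_eq (by field_simp)⟩
  have h1a := h1.trans (min_le_left _ _)
  have h1b := h1.trans (min_le_right _ _)
  obtain ⟨N, hN⟩ := exists_nat_ge ((|x| + |α - 1| + |c + α|) / ε + |c + α|)
  set M : ℕ → ℝ := fun n => |a (n + 1)| + K * |a (n + 1) - a n| with hM
  have hMnn : ∀ n, 0 ≤ M n := fun n => by positivity
  have key : ∀ n, N ≤ n → M (n + 1) ≤ (1 + δ) * M n := by
    intro n hn
    have hn' : (N : ℝ) ≤ n := by exact_mod_cast hn
    have hbig : (|x| + |α - 1| + |c + α|) / ε ≤ n := by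
      have := abs_nonneg (c + α); linarith
    have hca : |c + α| ≤ n := by
      have : 0 ≤ (|x| + |α - 1| + |c + α|) / ε := by positivity
      linarith
    rw [div_le_iff₀ hε] at hbig
    have hn0 : (0 : ℝ) ≤ n := Nat.cast_nonneg n
    have hx : |x| ≤ ε * ((n : ℝ) + 1 + c + 1) := by
      have := abs_nonneg (α - 1); have := abs_nonneg (c + α); nlinarith
    have hq : |(n : ℝ) + 1 + c + α| ≤ (1 + ε) * ((n : ℝ) + 1 + c + 1) := by
      have h2 := neg_abs_le (c + α)
      rw [abs_of_nonneg (by linarith)]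
      have := abs_nonneg x; have := abs_nonneg (c + α); have := le_abs_self (α - 1); nlinarith
    have hP : 0 < (n : ℝ) + 1 + c + 1 := by positivity
    have hd : |a (n + 2) - a (n + 1)| ≤ (1 + ε) * |a (n + 1) - a n| + ε * |a (n + 1)| := by
      have e : ((n : ℝ) + 1 + c + 1) * (a (n + 2) - a (n + 1))
          = ((n : ℝ) + 1 + c + α) * (a (n + 1) - a n) - x * a (n + 1) := by
        linear_combination - hr n
      have e2 : ((n : ℝ) + 1 + c + 1) * |a (n + 2) - a (n + 1)|
          ≤ |(n : ℝ) + 1 + c + α| * |a (n + 1) - a n| + |x| * |a (n + 1)| := by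
        rw [← abs_of_pos hP, ← abs_mul, e, ← abs_mul, ← abs_mul]
        exact abs_sub _ _
      have e3 := mul_le_mul_of_nonneg_right hq (abs_nonneg (a (n + 1) - a n))
      have e4 := mul_le_mul_of_nonneg_right hx (abs_nonneg (a (n + 1)))
      refine le_of_mul_le_mul_left ?_ hP
      linarith
    have ha : |a (n + 2)| ≤ |a (n + 1)| + |a (n + 2) - a (n + 1)| := by
      have := abs_add_le (a (n + 1)) (a (n + 2) - a (n + 1))
      simpa using this
    simp only [hM]
    have e5 := mul_le_mul_of_nonneg_left hd (by positivity : 0 ≤ 1 + K)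
    have e6 := mul_le_mul_of_nonneg_right h1a (abs_nonneg (a (n + 1)))
    have e7 : (1 + K) * (1 + ε) * |a (n + 1) - a n| ≤ (1 + δ) * K * |a (n + 1) - a n| :=
      mul_le_mul_of_nonneg_right (by linarith) (abs_nonneg _)
    change |a (n + 2)| + K * |a (n + 2) - a (n + 1)| ≤ _
    linarith
  have hs : Summable (fun n => M n * w ^ n) := by
    refine summable_of_ratio_norm_eventually_le (r := (1 + δ) * w) hδw ?_
    filter_upwards [Filter.eventually_ge_atTop N] with n hn
    have hp : 0 < w ^ n := by positivity
    rw [Real.norm_of_nonneg (mul_nonneg (hMnn _) (by positivity)),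
      Real.norm_of_nonneg (mul_nonneg (hMnn _) (by positivity)), pow_succ]
    have := mul_le_mul_of_nonneg_right (key n hn) (mul_pos hp hw0).le
    linarith
  rw [← summable_nat_add_iff 1]
  refine Summable.of_nonneg_of_le (fun n => by positivity) (fun n => ?_) (hs.mul_left w)
  have h3 : |a (n + 1)| ≤ M n := by
    simp only [hM]; have : 0 ≤ K * |a (n + 1) - a n| := by positivity
    linarith
  have := mul_le_mul_of_nonneg_right h3 (by positivity : 0 ≤ w ^ (n + 1))
  calc _ ≤ _ := this
    _ = _ := by ring

theorem aux_summable' (a : ℕ → ℝ)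
    (h : ∀ w : ℝ, 0 < w → w < 1 → Summable (fun n : ℕ => |a n| * w ^ n))
    (r : ℝ) (hr0 : 0 < r) (hr : r < 1) :
    Summable (fun n : ℕ => |a n| * (n * r ^ (n - 1))) := by
  obtain ⟨s, hrs, hs1⟩ := exists_between hr
  have hs0 : 0 < s := hr0.trans hrs
  have h1 := h s hs0 hs1
  have hq : ‖r / s‖ < 1 := by
    rw [Real.norm_of_nonneg (by positivity), div_lt_one hs0]; exact hrs
  have h2 := summable_pow_mul_geometric_of_norm_lt_one 1 hq
  have h3 : Summable (fun n : ℕ => (|a n| * s ^ n) * ((n : ℝ) ^ 1 * (r / s) ^ n)) := by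
    refine Summable.mul_norm h1.norm h2.norm |>.of_norm.comp_injective
      (i := fun n : ℕ => (n, n)) (fun a b h => (Prod.ext_iff.1 h).1)
  refine (h3.mul_left r⁻¹).congr (fun n => ?_)
  rcases n with _ | n
  · simp
  · rw [div_pow, Nat.add_sub_cancel]; field_simp; ring

theorem stmt5 (α c μ : ℝ) (hc : 0 ≤ c) (hca : -1 < c + α) (hca0 : c + α ≠ 0)
    (L : ℤ → ℝ → ℝ)
    (hinitm : ∀ x : ℝ, L (-1) x = μ / (c + α))
    (hinit0 : ∀ x : ℝ, L 0 x = 1)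
    (hrec : ∀ n : ℕ, ∀ x : ℝ,
      (2 * (n : ℝ) + 2 * c + α + 1 - x) * L (n : ℤ) x
        = ((n : ℝ) + c + 1) * L ((n : ℤ) + 1) x + ((n : ℝ) + c + α) * L ((n : ℤ) - 1) x)
    (x : ℝ) :
    (∀ w : ℝ, |w| < 1 → Summable (fun n : ℕ => L (n : ℤ) x * w ^ n)) ∧
    (∀ w : ℝ, |w| < 1 →
      w * (1 - w) ^ 2 * deriv (fun t : ℝ => ∑' n : ℕ, L (n : ℤ) x * t ^ n) w
        + ((1 - w) * (c - (c + α + 1) * w) + x * w) * (∑' n : ℕ, L (n : ℤ) x * w ^ n)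
        = c - μ * w) := by
  set a : ℕ → ℝ := fun n => L (n : ℤ) x with ha
  have ha0 : a 0 = 1 := by simpa [ha] using hinit0 x
  have hr : ∀ n : ℕ, (2 * ((n : ℝ) + 1) + 2 * c + α + 1 - x) * a (n + 1)
      = ((n : ℝ) + 1 + c + 1) * a (n + 2) + ((n : ℝ) + 1 + c + α) * a n := by
    intro n
    have h := hrec (n + 1) x
    have e1 : ((n + 1 : ℕ) : ℤ) + 1 = ((n + 2 : ℕ) : ℤ) := by push_cast; ring
    have e2 : ((n + 1 : ℕ) : ℤ) - 1 = (n : ℤ) := by push_cast; ring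
    rw [e1, e2] at h
    simp only [ha]
    rw [Nat.cast_add n 1, Nat.cast_one] at h
    exact h
  have hr0 : 2 * c + α + 1 - x = (c + 1) * a 1 + μ := by
    have h := hrec 0 x
    simp only [Nat.cast_zero, zero_sub, hinit0, hinitm] at h
    have e : (c + α) * (μ / (c + α)) = μ := by field_simp
    have e1 : L (0 + 1) x = a 1 := by simp [ha]
    rw [e1] at h
    linarith
  have hS := aux_summable a α c x hc hr
  have hS' := aux_summable' a hS
  have hsum : ∀ w : ℝ, |w| < 1 → Summable (fun n : ℕ => a n * w ^ n) := by
    intro w hw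
    obtain ⟨r, hwr, hr1⟩ := exists_between hw
    have hr0 : 0 < r := (abs_nonneg w).trans_lt hwr
    refine Summable.of_norm_bounded (hS r hr0 hr1) (fun n => ?_)
    rw [norm_mul, norm_pow, Real.norm_eq_abs, Real.norm_eq_abs]
    gcongr
  refine ⟨hsum, fun w hw => ?_⟩
  obtain ⟨r, hwr, hr1⟩ := exists_between hw
  have hrpos : 0 < r := (abs_nonneg w).trans_lt hwr
  have hD := hasDerivAt_tsum_of_isPreconnected (g := fun (n : ℕ) (t : ℝ) => a n * t ^ n)
    (g' := fun (n : ℕ) (t : ℝ) => a n * (n * t ^ (n - 1)))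
    (t := Metric.ball 0 r) (y₀ := 0) (y := w) (hS' r hrpos hr1) Metric.isOpen_ball
    (convex_ball (0 : ℝ) r).isPreconnected
    (fun n y _ => (hasDerivAt_pow n y).const_mul (a n))
    (fun n y hy => by
      rw [Metric.mem_ball, dist_zero_right] at hy
      rw [norm_mul, norm_mul, norm_pow, Real.norm_eq_abs, Real.norm_natCast]
      gcongr)
    (Metric.mem_ball_self hrpos) (hsum 0 (by simp))
    (by rw [Metric.mem_ball, dist_zero_right]; exact hwr)
  have hDs : Summable (fun n : ℕ => a n * (n * w ^ (n - 1))) := by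
    refine Summable.of_norm_bounded (hS' r hrpos hr1) (fun n => ?_)
    rw [norm_mul, norm_mul, norm_pow, Real.norm_eq_abs, Real.norm_natCast, Real.norm_eq_abs]
    gcongr
  rw [hD.deriv]
  have hF := (hsum w hw).hasSum
  have hT := hDs.hasSum.mul_left w
  change w * (1 - w) ^ 2 * (∑' n : ℕ, a n * (n * w ^ (n - 1)))
    + ((1 - w) * (c - (c + α + 1) * w) + x * w) * (∑' n : ℕ, a n * w ^ n) = c - μ * w
  generalize (∑' n : ℕ, a n * w ^ n) = F at hF ⊢
  generalize (∑' n : ℕ, a n * (n * w ^ (n - 1))) = D at hT ⊢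
  have hT0 : HasSum (fun n : ℕ => n * a n * w ^ n) (w * D) := by
    refine hT.congr_fun ?_
    intro n
    rcases n with _ | n
    · simp
    · rw [Nat.add_sub_cancel]; ring
  have hF1 := (hasSum_nat_add_iff' 1).2 hF
  have hF2 := (hasSum_nat_add_iff' 2).2 hF
  have hT1 := (hasSum_nat_add_iff' 1).2 hT0
  have hT2 := (hasSum_nat_add_iff' 2).2 hT0
  simp only [Finset.sum_range_succ, Finset.sum_range_zero, ha0] at hF1 hF2 hT1 hT2
  have hA := hT2.add (hF2.mul_left c)
  have hB := ((hT1.mul_left (2 * w)).add (hF1.mul_left ((2 * c + α + 1 - x) * w))).sub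
    ((hT0.add (hF.mul_left (1 + c + α))).mul_left (w ^ 2))
  have hAB := hA.unique (hB.congr_fun (fun n => by
    push_cast
    linear_combination (- w ^ (n + 2)) * hr n))
  simp at hAB
  linear_combination hAB - w * hr0
end

section
/- Let b, d, e be complex numbers such that d and e are not nonpositive integers, and define y(x) = ₂F₂(b, e+1; d, e; x) = ∑_{k=0}^∞ (b)_k (e+1)_k x^k / ((d)_k (e)_k k!). Then y is an entire function and for every complex x, x[(b−e)x + e(d−e−1)] y''(x) − { (b−e)x² + [ e(2d−e−2) + b(1−d) ]x − ed(d−e−1) } y'(x) − b[ (b−e)x + (e+1)(d−e−1) ] y(x) = 0. -/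
/-- Hypergeometric series `₂F₂(a, b; c, d; x)`. -/
noncomputable def hyp2F2 (a b c d x : ℂ) : ℂ :=
  ∑' k : ℕ, pochC a k * pochC b k * x ^ k / (pochC c k * pochC d k * (Nat.factorial k : ℂ))

theorem ps_deriv_summable (c : ℕ → ℂ) (H : ∀ z : ℂ, Summable fun k => c k * z ^ k) :
    ∀ z : ℂ, Summable fun k : ℕ => (((k : ℂ) + 1) * c (k + 1)) * z ^ k := by
  intro z
  have h1 := ((summable_nat_add_iff 1).2 (H ((2 * (‖z‖ + 1) : ℝ) : ℂ))).norm
  refine Summable.of_norm_bounded h1 ?_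
  intro k
  have hz : 0 ≤ ‖z‖ := norm_nonneg z
  have hn : ‖(k : ℂ) + 1‖ = (k : ℝ) + 1 := by
    have : (k : ℂ) + 1 = ((k + 1 : ℕ) : ℂ) := by push_cast; ring
    rw [this, Complex.norm_natCast]; push_cast; ring
  have h2 : ((k : ℝ) + 1) ≤ 2 ^ (k + 1) := by
    have := (Nat.lt_two_pow_self (n := k + 1)).le
    exact_mod_cast this
  have h3 : ‖z‖ ^ k ≤ (‖z‖ + 1) ^ (k + 1) := by
    calc ‖z‖ ^ k ≤ (‖z‖ + 1) ^ k := by gcongr; linarith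
      _ ≤ (‖z‖ + 1) ^ (k + 1) := by
        apply pow_le_pow_right₀ <;> linarith
  rw [norm_mul, norm_mul, norm_mul, norm_pow, norm_pow, hn, Complex.norm_real, Real.norm_eq_abs,
    abs_of_nonneg (by positivity), mul_pow]
  calc ((k : ℝ) + 1) * ‖c (k + 1)‖ * ‖z‖ ^ k
      = ‖c (k + 1)‖ * (((k : ℝ) + 1) * ‖z‖ ^ k) := by ring
    _ ≤ _ := by gcongr

theorem ps_deriv (c : ℕ → ℂ) (H : ∀ z : ℂ, Summable fun k => c k * z ^ k) (x : ℂ) :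
    HasDerivAt (fun z : ℂ => ∑' k, c k * z ^ k)
      (∑' k : ℕ, (((k : ℂ) + 1) * c (k + 1)) * x ^ k) x := by
  have hu : Summable fun k : ℕ => ‖c k * (((‖x‖ + 1 : ℝ)) : ℂ) ^ k‖ := (H _).norm
  have hx : x ∈ Metric.ball (0 : ℂ) (‖x‖ + 1) := by simp
  have hdf : ∀ k : ℕ, DifferentiableOn ℂ (fun z : ℂ => c k * z ^ k)
      (Metric.ball (0 : ℂ) (‖x‖ + 1)) := fun k => by fun_prop
  have hle : ∀ (k : ℕ) (w : ℂ), w ∈ Metric.ball (0 : ℂ) (‖x‖ + 1) →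
      ‖c k * w ^ k‖ ≤ ‖c k * (((‖x‖ + 1 : ℝ)) : ℂ) ^ k‖ := by
    intro k w hw
    rw [mem_ball_zero_iff] at hw
    rw [norm_mul, norm_mul, norm_pow, norm_pow, Complex.norm_real, Real.norm_eq_abs,
      abs_of_nonneg (by positivity)]
    gcongr
  have h1 := Complex.hasSum_deriv_of_summable_norm hu hdf Metric.isOpen_ball hle hx
  have h2 := (Complex.differentiableOn_tsum_of_summable_norm hu hdf Metric.isOpen_ball hle).differentiableAt
    (Metric.isOpen_ball.mem_nhds hx)
  have h3 := (hasSum_nat_add_iff' 1).2 h1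
  have h4 : deriv (fun z : ℂ => ∑' k, c k * z ^ k) x
      = ∑' k : ℕ, (((k : ℂ) + 1) * c (k + 1)) * x ^ k := by
    rw [show (fun k : ℕ => (((k : ℂ) + 1) * c (k + 1)) * x ^ k) =
      fun k : ℕ => deriv (fun z : ℂ => c (k + 1) * z ^ (k + 1)) x from ?_, h3.tsum_eq]
    · simp
    · funext k
      simp
      ring
  rw [← h4]
  exact h2.hasDerivAt

theorem ps_summable (b d e : ℂ) (hd : ∀ k : ℕ, d + k ≠ 0) (he : ∀ k : ℕ, e + k ≠ 0) (c : ℕ → ℂ)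
    (hc : ∀ k : ℕ, c (k + 1) * ((d + k) * (e + k) * (k + 1)) = c k * ((b + k) * (e + 1 + k)))
    (z : ℂ) : Summable fun k => c k * z ^ k := by
  have hinv : Filter.Tendsto (fun k : ℕ => ((k : ℂ))⁻¹) Filter.atTop (nhds 0) :=
    tendsto_inv_atTop_nhds_zero_nat (𝕜 := ℂ)
  have h1 : Filter.Tendsto (fun k : ℕ => (b * (k : ℂ)⁻¹ + 1) * ((e + 1) * (k : ℂ)⁻¹ + 1) * (z * (k : ℂ)⁻¹) /
      ((d * (k : ℂ)⁻¹ + 1) * (e * (k : ℂ)⁻¹ + 1) * (1 + (k : ℂ)⁻¹))) Filter.atTop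
      (nhds ((b * 0 + 1) * ((e + 1) * 0 + 1) * (z * 0) / ((d * 0 + 1) * (e * 0 + 1) * (1 + 0)))) := by
    refine Filter.Tendsto.div ?_ ?_ (by simp)
    · exact (((hinv.const_mul b).add_const 1).mul ((hinv.const_mul (e + 1)).add_const 1)).mul
        (hinv.const_mul z)
    · exact (((hinv.const_mul d).add_const 1).mul ((hinv.const_mul e).add_const 1)).mul
        (hinv.const_add 1)
  have h2 := h1.norm
  simp only [mul_zero, zero_div, norm_zero] at h2
  have h3 := h2.eventually (gt_mem_nhds (show (0 : ℝ) < 1 / 2 by norm_num))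
  refine summable_of_ratio_norm_eventually_le (r := 1 / 2) (by norm_num) ?_
  filter_upwards [h3, Filter.eventually_gt_atTop 0] with k hk hk0
  have hk0' : (k : ℂ) ≠ 0 := by exact_mod_cast hk0.ne'
  have hk1 : (k : ℂ) + 1 ≠ 0 := by exact_mod_cast (Nat.succ_ne_zero k)
  have hdk := hd k
  have hek := he k
  have key : c (k + 1) * z ^ (k + 1) = ((b * (k : ℂ)⁻¹ + 1) * ((e + 1) * (k : ℂ)⁻¹ + 1) * (z * (k : ℂ)⁻¹) /
      ((d * (k : ℂ)⁻¹ + 1) * (e * (k : ℂ)⁻¹ + 1) * (1 + (k : ℂ)⁻¹))) * (c k * z ^ k) := by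
    have hq : (b * (k : ℂ)⁻¹ + 1) * ((e + 1) * (k : ℂ)⁻¹ + 1) * (z * (k : ℂ)⁻¹) /
      ((d * (k : ℂ)⁻¹ + 1) * (e * (k : ℂ)⁻¹ + 1) * (1 + (k : ℂ)⁻¹)) =
        (b + k) * (e + 1 + k) * z / ((d + k) * (e + k) * (k + 1)) := by
      rw [show d * (k : ℂ)⁻¹ + 1 = (d + k) * (k : ℂ)⁻¹ by field_simp,
        show e * (k : ℂ)⁻¹ + 1 = (e + k) * (k : ℂ)⁻¹ by field_simp,
        show 1 + (k : ℂ)⁻¹ = (k + 1) * (k : ℂ)⁻¹ by field_simp]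
      field_simp
    rw [hq, eq_comm, div_mul_eq_mul_div, div_eq_iff (by simp [hdk, hek, hk1])]
    linear_combination (-z ^ (k + 1)) * hc k
  rw [key, norm_mul]
  gcongr

theorem shift_up (f : ℕ → ℂ) (s : ℂ) (h0 : f 0 = 0) (h : HasSum (fun n => f (n + 1)) s) :
    HasSum f s := by
  have := (hasSum_nat_add_iff' (f := f) (g := s) 1).1 (by simpa [h0] using h)
  exact this

theorem pochC_ne_s8 (d : ℂ) (hd : ∀ k : ℕ, d + k ≠ 0) (k : ℕ) : pochC d k ≠ 0 := by
  induction k with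
  | zero => simp [pochC]
  | succ k ih =>
    unfold pochC at *
    rw [ascPochhammer_succ_eval]
    exact mul_ne_zero ih (hd k)

theorem stmt8 (b d e : ℂ)
    (hd : ∀ k : ℕ, d ≠ -(k : ℂ))
    (he : ∀ k : ℕ, e ≠ -(k : ℂ)) :
    Differentiable ℂ (fun x : ℂ => hyp2F2 b (e + 1) d e x) ∧
    ∀ x : ℂ,
      x * ((b - e) * x + e * (d - e - 1)) *
          iteratedDeriv 2 (fun t : ℂ => hyp2F2 b (e + 1) d e t) x
        - ((b - e) * x ^ 2 + (e * (2 * d - e - 2) + b * (1 - d)) * x - e * d * (d - e - 1)) *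
          deriv (fun t : ℂ => hyp2F2 b (e + 1) d e t) x
        - b * ((b - e) * x + (e + 1) * (d - e - 1)) * hyp2F2 b (e + 1) d e x = 0 := by
  have hd' : ∀ k : ℕ, d + k ≠ 0 := fun k h => hd k (eq_neg_of_add_eq_zero_left h)
  have he' : ∀ k : ℕ, e + k ≠ 0 := fun k h => he k (eq_neg_of_add_eq_zero_left h)
  obtain ⟨c, hcdef⟩ : ∃ c : ℕ → ℂ, c = fun k => pochC b k * pochC (e + 1) k /
    (pochC d k * pochC e k * (Nat.factorial k : ℂ)) := ⟨_, rfl⟩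
  have hF : ∀ x, hyp2F2 b (e + 1) d e x = ∑' k, c k * x ^ k := by
    intro x
    unfold hyp2F2
    congr 1
    funext k
    rw [hcdef]
    ring
  have hc : ∀ k : ℕ, c (k + 1) * ((d + k) * (e + k) * (k + 1)) = c k * ((b + k) * (e + 1 + k)) := by
    intro k
    have hs : ∀ a : ℂ, pochC a (k + 1) = pochC a k * (a + k) := fun a => by
      unfold pochC; rw [ascPochhammer_succ_eval]
    have h1 := pochC_ne_s8 d hd' k
    have h2 := pochC_ne_s8 e he' k
    have h3 := hd' k
    have h4 := he' k
    have h5 : (k : ℂ) + 1 ≠ 0 := by exact_mod_cast (Nat.succ_ne_zero k)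
    have h6 : (Nat.factorial k : ℂ) ≠ 0 := by exact_mod_cast Nat.factorial_ne_zero k
    rw [hcdef]
    simp only [hs, Nat.factorial_succ]
    push_cast
    field_simp
  clear hcdef
  have H0 : ∀ z : ℂ, Summable fun k => c k * z ^ k := ps_summable b d e hd' he' c hc
  have H1 := ps_deriv_summable c H0
  have H2 := ps_deriv_summable _ H1
  have D1 := ps_deriv c H0
  have D2 := ps_deriv _ H1
  simp only [hF]
  refine ⟨fun x => (D1 x).differentiableAt, fun x => ?_⟩
  have e1 : deriv (fun t : ℂ => ∑' k, c k * t ^ k) =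
    fun x => ∑' k : ℕ, (((k : ℂ) + 1) * c (k + 1)) * x ^ k := funext fun x => (D1 x).deriv
  rw [iteratedDeriv_succ, iteratedDeriv_one, e1, (D2 x).deriv]
  have S0 := (H0 x).hasSum
  have S1 := (H1 x).hasSum
  have S2 := (H2 x).hasSum
  beta_reduce
  generalize (∑' k, c k * x ^ k) = y0 at *
  generalize (∑' k : ℕ, (((k : ℂ) + 1) * c (k + 1)) * x ^ k) = y1 at *
  generalize (∑' k : ℕ, (((k : ℂ) + 1) * ((((k + 1 : ℕ) : ℂ) + 1) * c (k + 1 + 1))) * x ^ k) = y2 at *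
  have T1 : HasSum (fun m : ℕ => (m : ℂ) * c m * x ^ m) (x * y1) := by
    apply shift_up _ _ (by simp)
    refine Eq.mp (congrArg (fun g => HasSum g (x * y1)) (funext fun k => ?_)) (S1.mul_left x)
    push_cast; ring
  have T2 : HasSum (fun m : ℕ => (m : ℂ) * ((m : ℂ) + 1) * c (m + 1) * x ^ m) (x * y2) := by
    apply shift_up _ _ (by simp)
    refine Eq.mp (congrArg (fun g => HasSum g (x * y2)) (funext fun k => ?_)) (S2.mul_left x)
    push_cast; ring
  have U0 := (hasSum_nat_add_iff' 1).2 S0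
  have U1 := (hasSum_nat_add_iff' 1).2 S1
  simp only [Finset.sum_range_one, Nat.cast_zero, pow_zero, mul_one, zero_add, one_mul] at U0 U1
  have tot := (((((T2.mul_left ((b - e) * x)).add (S2.mul_left (e * (d - e - 1) * x))).sub
    (T1.mul_left ((b - e) * x))).sub
    (S1.mul_left ((e * (2 * d - e - 2) + b * (1 - d)) * x))).add
    (U1.mul_left (e * d * (d - e - 1)))).sub
    ((S0.mul_left (b * (b - e) * x)).add (U0.mul_left (b * (e + 1) * (d - e - 1))))
  have hz := tot.unique (a₂ := 0) (by
    convert hasSum_zero using 1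
    funext m
    have r1 := hc m
    have r2 := hc (m + 1)
    push_cast at r2 ⊢
    have hne : e + 1 + (m : ℂ) ≠ 0 := by
      have := he' (m + 1)
      push_cast at this
      intro h
      exact this (by linear_combination h)
    apply mul_left_cancel₀ hne
    linear_combination x ^ (m + 1) * (e * (d - e - 1) * r2 + (b - e) * r1))
  have r0 := hc 0
  simp only [Nat.cast_zero, add_zero, zero_add, mul_one] at r0
  linear_combination hz + (d - e - 1) * r0
end

section
/- Let I, J, v, w be infinitely differentiable real-valued functions on an open interval such that v'' + I v = 0, w'' + J w = 0, and I(x) − J(x) ≠ 0 for all x in the interval. Then the product u = v·w satisfies the fourth-order differential equation d/dx [ (u''' + 2(I+J) u' + (I'+J') u) / (I−J) ] = −(I−J) u on the interval. -/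
theorem stmt9 (a b : ℝ) (I J v w : ℝ → ℝ)
    (hI : ContDiffOn ℝ (⊤ : ℕ∞) I (Set.Ioo a b))
    (hJ : ContDiffOn ℝ (⊤ : ℕ∞) J (Set.Ioo a b))
    (hv : ContDiffOn ℝ (⊤ : ℕ∞) v (Set.Ioo a b))
    (hw : ContDiffOn ℝ (⊤ : ℕ∞) w (Set.Ioo a b))
    (hveq : ∀ x ∈ Set.Ioo a b, iteratedDeriv 2 v x + I x * v x = 0)
    (hweq : ∀ x ∈ Set.Ioo a b, iteratedDeriv 2 w x + J x * w x = 0)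
    (hIJ : ∀ x ∈ Set.Ioo a b, I x - J x ≠ 0) :
    ∀ x ∈ Set.Ioo a b,
      deriv (fun t : ℝ =>
          (iteratedDeriv 3 (fun s : ℝ => v s * w s) t
            + 2 * (I t + J t) * deriv (fun s : ℝ => v s * w s) t
            + (deriv I t + deriv J t) * (v t * w t)) / (I t - J t)) x
        = -(I x - J x) * (v x * w x) := by
  have hd : ∀ f : ℝ → ℝ, ContDiffOn ℝ (⊤ : ℕ∞) f (Set.Ioo a b) →
      ∀ x ∈ Set.Ioo a b, HasDerivAt f (deriv f x) x := by
    intro f hf x hx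
    exact ((hf.differentiableOn (by simp)).differentiableAt (isOpen_Ioo.mem_nhds hx)).hasDerivAt
  have hd2 : ∀ f : ℝ → ℝ, ContDiffOn ℝ (⊤ : ℕ∞) f (Set.Ioo a b) →
      ContDiffOn ℝ (⊤ : ℕ∞) (deriv f) (Set.Ioo a b) := by
    intro f hf
    exact hf.deriv_of_isOpen isOpen_Ioo (by simp)
  have hv1 := hd v hv
  have hw1 := hd w hw
  have hI1 := hd I hI
  have hJ1 := hd J hJ
  have hv2 : ∀ x ∈ Set.Ioo a b, HasDerivAt (deriv v) (-(I x * v x)) x := by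
    intro x hx
    have h := hd _ (hd2 v hv) x hx
    have e := hveq x hx
    rw [iteratedDeriv_succ, iteratedDeriv_one] at e
    rwa [eq_neg_of_add_eq_zero_left e] at h
  have hw2 : ∀ x ∈ Set.Ioo a b, HasDerivAt (deriv w) (-(J x * w x)) x := by
    intro x hx
    have h := hd _ (hd2 w hw) x hx
    have e := hweq x hx
    rw [iteratedDeriv_succ, iteratedDeriv_one] at e
    rwa [eq_neg_of_add_eq_zero_left e] at h
  have key : ∀ (f g : ℝ → ℝ), (∀ x ∈ Set.Ioo a b, f x = g x) →
      ∀ x ∈ Set.Ioo a b, deriv f x = deriv g x := by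
    intro f g h x hx
    exact Filter.EventuallyEq.deriv_eq (Filter.eventually_of_mem (isOpen_Ioo.mem_nhds hx) h)
  have u1 : ∀ x ∈ Set.Ioo a b, deriv (fun s : ℝ => v s * w s) x
      = deriv v x * w x + v x * deriv w x := fun x hx => ((hv1 x hx).mul (hw1 x hx)).deriv
  have u2 : ∀ x ∈ Set.Ioo a b, deriv (deriv (fun s : ℝ => v s * w s)) x
      = -((I x + J x) * (v x * w x)) + 2 * (deriv v x * deriv w x) := by
    intro x hx
    rw [key _ (fun x => deriv v x * w x + v x * deriv w x) u1 x hx]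
    refine (((hv2 x hx).mul (hw1 x hx)).add ((hv1 x hx).mul (hw2 x hx))).deriv.trans ?_
    ring
  have u3 : ∀ x ∈ Set.Ioo a b, iteratedDeriv 3 (fun s : ℝ => v s * w s) x
      = -((deriv I x + deriv J x) * (v x * w x)
          + (I x + J x) * (deriv v x * w x + v x * deriv w x))
        + 2 * (-(I x * v x) * deriv w x + deriv v x * -(J x * w x)) := by
    intro x hx
    rw [iteratedDeriv_succ, iteratedDeriv_succ, iteratedDeriv_one, key _
      (fun x => -((I x + J x) * (v x * w x)) + 2 * (deriv v x * deriv w x)) u2 x hx]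
    exact (((((hI1 x hx).add (hJ1 x hx)).mul ((hv1 x hx).mul (hw1 x hx))).neg).add
      (((hv2 x hx).mul (hw2 x hx)).const_mul 2)).deriv
  intro x hx
  rw [key _ (fun t => deriv v t * w t - v t * deriv w t) _ x hx]
  · refine (((hv2 x hx).mul (hw1 x hx)).sub ((hv1 x hx).mul (hw2 x hx))).deriv.trans ?_
    ring
  · intro t ht
    rw [u3 t ht, u1 t ht, div_eq_iff (hIJ t ht)]
    ring
end

section
/- Let α, c be real numbers with c ≥ 0 and c+α > −1, let n ≥ 0 be an integer, and let y(x) = L_n^α(x; c) be the n-th associated Laguerre polynomial. With F = n + 2c + α, the function y satisfies the fourth-order differential equation x² y⁗(x) + 5x y'''(x) + (−x(x − 2F) − α² + 4) y''(x) + 3(F − x) y'(x) + n(n+2) y(x) = 0 for all real x. -/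
open Polynomial in
lemma aux_step (n c a P S R T : ℝ[X])
    (h1 : X * derivative P = n * P - (n + c + a) * S + R)
    (h2 : X * derivative S = (X - n - 2 * c - a) * S + (n + c) * P + T)
    (h3 : X * derivative R = (n + 2 * c + a - X) * R - (n + c + a) * T - c * (c + a) * P)
    (h4 : X * derivative T = (n + c) * R - n * T - c * (c + a) * S)
    (D p s r t : ℝ[X]) (k : ℕ)
    (h : X ^ (k+1) * D = p * P + s * S + r * R + t * T) :
    X ^ (k + 2) * derivative D =
      (X * derivative p - ((k : ℝ[X]) + 1) * p + p * n + s * (n + c) - r * (c * (c + a))) * P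
      + (X * derivative s - ((k : ℝ[X]) + 1) * s - p * (n + c + a) + s * (X - n - 2 * c - a)
          - t * (c * (c + a))) * S
      + (X * derivative r - ((k : ℝ[X]) + 1) * r + p + r * (n + 2 * c + a - X) + t * (n + c)) * R
      + (X * derivative t - ((k : ℝ[X]) + 1) * t + s - r * (n + c + a) - t * n) * T := by
  have d := congrArg derivative h
  simp only [derivative_mul, derivative_add, derivative_X_pow, Nat.add_sub_cancel] at d
  simp only [map_natCast] at d
  push_cast at d
  linear_combination X * d - ((k : ℝ[X]) + 1) * h + p * h1 + s * h2 + r * h3 + t * h4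

open Polynomial in
lemma aux_ode (n c a P S R T : ℝ[X])
    (hn : derivative n = 0) (hc : derivative c = 0) (ha : derivative a = 0)
    (h1 : X * derivative P = n * P - (n + c + a) * S + R)
    (h2 : X * derivative S = (X - n - 2 * c - a) * S + (n + c) * P + T)
    (h3 : X * derivative R = (n + 2 * c + a - X) * R - (n + c + a) * T - c * (c + a) * P)
    (h4 : X * derivative T = (n + c) * R - n * T - c * (c + a) * S) :
    X ^ 2 * derivative (derivative (derivative (derivative P)))
      + 5 * X * derivative (derivative (derivative P))
      + (-X * (X - 2 * (n + 2 * c + a)) - a ^ 2 + 4) * derivative (derivative P)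
      + 3 * ((n + 2 * c + a) - X) * derivative P + n * (n + 2) * P = 0 := by
  have e1 : X ^ (0 + 1) * derivative P = n * P + (-(n + c + a)) * S + 1 * R + 0 * T := by
    linear_combination h1
  have e2 := aux_step n c a P S R T h1 h2 h3 h4 _ _ _ _ _ 0 e1
  have e3 := aux_step n c a P S R T h1 h2 h3 h4 _ _ _ _ _ 1 e2
  have e4 := aux_step n c a P S R T h1 h2 h3 h4 _ _ _ _ _ 2 e3
  simp only [derivative_mul, derivative_add, derivative_sub, derivative_neg, derivative_X, derivative_one,
    derivative_zero, derivative_ofNat, derivative_natCast, hn, hc, ha] at e2 e3 e4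
  norm_num only [Nat.cast_zero, Nat.cast_one, Nat.cast_ofNat, Nat.reduceAdd] at e2 e3 e4
  have hX : (X ^ 2 : ℝ[X]) ≠ 0 := pow_ne_zero _ X_ne_zero
  apply mul_left_cancel₀ hX
  linear_combination e4 + 5 * e3 + (-X * (X - 2 * (n + 2 * c + a)) - a ^ 2 + 4) * e2
    + 3 * ((n + 2 * c + a) - X) * X * e1

open Polynomial in
lemma aux_exists (α c : ℝ) (hc : 0 ≤ c)
    (L : ℤ → ℝ → ℝ)
    (hinitm : ∀ x : ℝ, L (-1) x = 0)
    (hinit0 : ∀ x : ℝ, L 0 x = 1)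
    (hrec : ∀ m : ℕ, ∀ x : ℝ,
      (2 * (m : ℝ) + 2 * c + α + 1 - x) * L (m : ℤ) x
        = ((m : ℝ) + c + 1) * L ((m : ℤ) + 1) x + ((m : ℝ) + c + α) * L ((m : ℤ) - 1) x)
    (n : ℕ) : ∃ P S R T : ℝ[X], (∀ x, L (n : ℤ) x = P.eval x) ∧ (∀ x, L ((n : ℤ) - 1) x = S.eval x)
      ∧ X * derivative P = (n : ℝ[X]) * P - ((n : ℝ[X]) + C c + C α) * S + R
      ∧ X * derivative S = (X - (n : ℝ[X]) - 2 * C c - C α) * S + ((n : ℝ[X]) + C c) * P + T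
      ∧ X * derivative R = ((n : ℝ[X]) + 2 * C c + C α - X) * R - ((n : ℝ[X]) + C c + C α) * T
          - C c * (C c + C α) * P
      ∧ X * derivative T = ((n : ℝ[X]) + C c) * R - (n : ℝ[X]) * T - C c * (C c + C α) * S := by
  induction n with
  | zero =>
    refine ⟨1, 0, 0, -C c, ?_, ?_, ?_, ?_, ?_, ?_⟩
    · simpa using hinit0
    · simpa using hinitm
    · simp
    · simp
    · simp; ring
    · simp
  | succ n ih =>
    obtain ⟨P, S, R, T, hP, hS, h1, h2, h3, h4⟩ := ih
    have hpos : (n : ℝ) + c + 1 ≠ 0 := by positivity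
    have hi : ((n : ℝ[X]) + C c + 1) * C (((n : ℝ) + c + 1)⁻¹) = 1 := by
      have : ((n : ℝ[X]) + C c + 1) = C ((n : ℝ) + c + 1) := by simp
      rw [this, ← C_mul, mul_inv_cancel₀ hpos, C_1]
    have hne : ((n : ℝ[X]) + C c + 1) ≠ 0 := left_ne_zero_of_mul_eq_one hi
    obtain ⟨Pn, hPn⟩ : ∃ Q : ℝ[X], ((n : ℝ[X]) + C c + 1) * Q
        = (2 * (n : ℝ[X]) + 2 * C c + C α + 1 - X) * P - ((n : ℝ[X]) + C c + C α) * S :=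
      ⟨C (((n : ℝ) + c + 1)⁻¹) * ((2 * (n : ℝ[X]) + 2 * C c + C α + 1 - X) * P - ((n : ℝ[X]) + C c + C α) * S), by
        rw [← mul_assoc, hi, one_mul]⟩
    obtain ⟨Rn, hRn⟩ : ∃ Q : ℝ[X], ((n : ℝ[X]) + C c + 1) * Q
        = (2 * (n : ℝ[X]) + 2 * C c + C α + 1 - X) * R - ((n : ℝ[X]) + C c + C α) * T :=
      ⟨C (((n : ℝ) + c + 1)⁻¹) * ((2 * (n : ℝ[X]) + 2 * C c + C α + 1 - X) * R - ((n : ℝ[X]) + C c + C α) * T), by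
        rw [← mul_assoc, hi, one_mul]⟩
    have dP := congrArg derivative hPn
    have dR := congrArg derivative hRn
    simp at dP dR
    refine ⟨Pn, P, Rn, R, ?_, ?_, ?_, ?_, ?_, ?_⟩
    · intro x
      have e := congrArg (eval x) hPn
      simp at e
      have := hrec n x
      rw [hP, hS] at this
      push_cast
      apply mul_left_cancel₀ hpos
      linarith
    · simpa using hP
    · apply mul_left_cancel₀ hne
      push_cast
      linear_combination X * dP + (2 * (n : ℝ[X]) + 2 * C c + C α + 1 - X) * h1
        - ((n : ℝ[X]) + C c + C α) * h2 - ((n : ℝ[X]) + 1) * hPn - hRn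
    · push_cast
      linear_combination h1 - hPn
    · apply mul_left_cancel₀ hne
      push_cast
      linear_combination X * dR + (2 * (n : ℝ[X]) + 2 * C c + C α + 1 - X) * h3
        - ((n : ℝ[X]) + C c + C α) * h4 - ((n : ℝ[X]) + 1 + 2 * C c + C α - X) * hRn + C c * (C c + C α) * hPn
    · push_cast
      linear_combination h3 - hRn

theorem stmt10 (α c : ℝ) (hc : 0 ≤ c) (hca : -1 < c + α)
    (L : ℤ → ℝ → ℝ)
    (hinitm : ∀ x : ℝ, L (-1) x = 0)
    (hinit0 : ∀ x : ℝ, L 0 x = 1)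
    (hrec : ∀ m : ℕ, ∀ x : ℝ,
      (2 * (m : ℝ) + 2 * c + α + 1 - x) * L (m : ℤ) x
        = ((m : ℝ) + c + 1) * L ((m : ℤ) + 1) x + ((m : ℝ) + c + α) * L ((m : ℤ) - 1) x)
    (n : ℕ) :
    ∀ x : ℝ,
      x ^ 2 * iteratedDeriv 4 (L (n : ℤ)) x
        + 5 * x * iteratedDeriv 3 (L (n : ℤ)) x
        + (-x * (x - 2 * ((n : ℝ) + 2 * c + α)) - α ^ 2 + 4) * iteratedDeriv 2 (L (n : ℤ)) x
        + 3 * (((n : ℝ) + 2 * c + α) - x) * deriv (L (n : ℤ)) x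
        + (n : ℝ) * ((n : ℝ) + 2) * L (n : ℤ) x = 0 := by
  intro x
  obtain ⟨P, S, R, T, hP, -, h1, h2, h3, h4⟩ := aux_exists α c hc L hinitm hinit0 hrec n
  have key := congrArg (Polynomial.eval x) (aux_ode (n : Polynomial ℝ) (Polynomial.C c)
    (Polynomial.C α) P S R T (by simp) (by simp) (by simp) h1 h2 h3 h4)
  have hL : L (n : ℤ) = fun y => P.eval y := funext hP
  have hd : ∀ Q : Polynomial ℝ, deriv (fun y => Q.eval y) = fun y => Q.derivative.eval y :=
    fun Q => funext fun y => Q.deriv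
  simp at key
  rw [hL]
  simp only [iteratedDeriv_succ', iteratedDeriv_zero, hd]
  linear_combination key
end

section
/- Let α, μ be real numbers with α > −1 and α ≠ 0, let n ≥ 0 be an integer, and let y(x) = L_n^α(x; 0, μ) be the n-th co-recursive Laguerre polynomial, i.e. the CAL polynomial with c = 0. Define A(x) = 3x + 2(x−α+μ)[2n(x−α+μ) + x − α − 1], B(x) = 1 + 2x − 2α + 2(1+4n)(x−α+μ), and C(x) = (1+2x−2α)[1+α−x−2n(x−α+μ)] + 3x(1+4n). Then y satisfies the factorized fourth-order differential equation [ xA(x)D² + ((2+α−x)A(x) − xB(x))D + (n−1)A(x) + (x−α−1)B(x) + C(x) ] ∘ [ xD² + (x+1−α)D + (n+1) ] y = 0, where D denotes differentiation with respect to x. -/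
/-- Coefficient `A(x)` of the outer factor. -/
noncomputable def coefA (α μ : ℝ) (n : ℕ) (x : ℝ) : ℝ :=
  3 * x + 2 * (x - α + μ) * (2 * (n : ℝ) * (x - α + μ) + x - α - 1)

/-- Coefficient `B(x)` of the outer factor. -/
noncomputable def coefB (α μ : ℝ) (n : ℕ) (x : ℝ) : ℝ :=
  1 + 2 * x - 2 * α + 2 * (1 + 4 * (n : ℝ)) * (x - α + μ)

/-- Coefficient `C(x)` of the outer factor. -/
noncomputable def coefC (α μ : ℝ) (n : ℕ) (x : ℝ) : ℝ :=
  (1 + 2 * x - 2 * α) * (1 + α - x - 2 * (n : ℝ) * (x - α + μ)) + 3 * x * (1 + 4 * (n : ℝ))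

/-- The second-order operator `x D² + (x+1−α) D + (n+1)` applied to `y`. -/
noncomputable def innerOp (α : ℝ) (n : ℕ) (y : ℝ → ℝ) : ℝ → ℝ :=
  fun x => x * iteratedDeriv 2 y x + (x + 1 - α) * deriv y x + ((n : ℝ) + 1) * y x

open Polynomial in
/-- Solutions of the Laguerre recurrence with prescribed first two terms. -/
noncomputable def lagSeq (α : ℝ) (p q : ℝ[X]) : ℕ → ℝ[X]
  | 0 => p
  | 1 => q
  | (n + 2) => C (((n : ℝ) + 2)⁻¹) *
      ((2 * (n : ℝ[X]) + 3 + C α - X) * lagSeq α p q (n + 1)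
        - ((n : ℝ[X]) + 1 + C α) * lagSeq α p q n)

open Polynomial in
lemma lagSeq_rec (α : ℝ) (p q : ℝ[X]) (n : ℕ) :
    ((n : ℝ[X]) + 2) * lagSeq α p q (n + 2) =
      (2 * (n : ℝ[X]) + 3 + C α - X) * lagSeq α p q (n + 1)
        - ((n : ℝ[X]) + 1 + C α) * lagSeq α p q n := by
  have h : ((n : ℝ[X]) + 2) * C (((n : ℝ) + 2)⁻¹) = 1 := by
    have h1 : ((n : ℝ[X]) + 2) = C ((n : ℝ) + 2) := by
      rw [C_add, map_natCast, map_ofNat]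
    rw [h1, ← C_mul, mul_inv_cancel₀ (by positivity), C_1]
  rw [lagSeq, ← mul_assoc, h, one_mul]

open Polynomial in
lemma lagSeq_drec (α : ℝ) (p q : ℝ[X]) (n : ℕ) :
    ((n : ℝ[X]) + 2) * derivative (lagSeq α p q (n + 2)) =
      (2 * (n : ℝ[X]) + 3 + C α - X) * derivative (lagSeq α p q (n + 1))
        - lagSeq α p q (n + 1)
        - ((n : ℝ[X]) + 1 + C α) * derivative (lagSeq α p q n) := by
  have h := congrArg derivative (lagSeq_rec α p q n)
  simp only [derivative_mul, derivative_add, derivative_sub, derivative_natCast, derivative_C,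
    derivative_X, derivative_ofNat, derivative_one] at h
  linear_combination h

/-- Laguerre polynomials. -/
noncomputable def lagP (α : ℝ) : ℕ → Polynomial ℝ :=
  lagSeq α 1 (Polynomial.C α + 1 - Polynomial.X)

/-- Associated polynomials. -/
noncomputable def lagQ (α : ℝ) : ℕ → Polynomial ℝ := lagSeq α 0 1

lemma lagP_fold (α : ℝ) :
    lagSeq α 1 (Polynomial.C α + 1 - Polynomial.X) = lagP α := rfl

lemma lagQ_fold (α : ℝ) : lagSeq α 0 1 = lagQ α := rfl

open Polynomial in
lemma two_ne (n : ℕ) : ((n : ℝ[X]) + 2) ≠ 0 := by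
  have : ((n + 2 : ℕ) : ℝ[X]) ≠ 0 := Nat.cast_ne_zero.mpr (by omega)
  simpa using this

open Polynomial in
lemma lagP_struct (α : ℝ) (n : ℕ) :
    (X * derivative (lagP α n) = ((n : ℝ[X]) + 1) * lagP α (n + 1)
      - ((n : ℝ[X]) + C α + 1 - X) * lagP α n) ∧
    (X * derivative (lagP α (n + 1)) = ((n : ℝ[X]) + 2) * lagP α (n + 2)
      - ((n : ℝ[X]) + C α + 2 - X) * lagP α (n + 1)) := by
  induction n with
  | zero =>
    have h := lagSeq_rec α 1 (C α + 1 - X) 0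
    constructor
    · simp [lagP, lagSeq]
    · simp only [lagP]
      push_cast at h ⊢
      simp only [zero_add] at h ⊢
      rw [h]
      simp [lagSeq]
      ring
  | succ n ih =>
    obtain ⟨h0, h1⟩ := ih
    refine ⟨by push_cast; linear_combination h1, ?_⟩
    have r0 := lagSeq_rec α 1 (C α + 1 - X) n
    have r1 := lagSeq_rec α 1 (C α + 1 - X) (n + 1)
    have d := lagSeq_drec α 1 (C α + 1 - X) n
    apply mul_left_cancel₀ (two_ne n)
    simp only [lagP_fold] at r0 r1 d
    change _ * _ = _ * (_ * lagP α (n + 3) - _)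
    push_cast at r1 ⊢
    change _ * lagP α (n + 3) = _ * lagP α (n + 2) - _ at r1
    change _ * (_ * derivative (lagP α (n + 2))) = _ * (_ - _ * lagP α (n + 2))
    linear_combination X * d + (2 * (n : ℝ[X]) + 3 + C α - X) * h1
      - ((n : ℝ[X]) + 1 + C α) * h0 - ((n : ℝ[X]) + 2) * r1
      + ((n : ℝ[X]) + C α + 1 - X) * r0

open Polynomial in
lemma lagQ_struct (α : ℝ) (n : ℕ) :
    (X * derivative (lagQ α n) = ((n : ℝ[X]) + 1) * lagQ α (n + 1)
      - ((n : ℝ[X]) + 1) * lagQ α n - lagP α n) ∧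
    (X * derivative (lagQ α (n + 1)) = ((n : ℝ[X]) + 2) * lagQ α (n + 2)
      - ((n : ℝ[X]) + 2) * lagQ α (n + 1) - lagP α (n + 1)) := by
  induction n with
  | zero =>
    have h := lagSeq_rec α 0 1 0
    constructor
    · simp [lagP, lagQ, lagSeq]
    · simp only [lagP, lagQ]
      push_cast at h ⊢
      simp only [zero_add] at h ⊢
      rw [h]
      simp [lagSeq]
      ring
  | succ n ih =>
    obtain ⟨h0, h1⟩ := ih
    refine ⟨by push_cast; linear_combination h1, ?_⟩
    have r0 := lagSeq_rec α 0 1 n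
    have p0 := lagSeq_rec α 1 (C α + 1 - X) n
    have r1 := lagSeq_rec α 0 1 (n + 1)
    have d := lagSeq_drec α 0 1 n
    apply mul_left_cancel₀ (two_ne n)
    simp only [lagP_fold, lagQ_fold] at r0 r1 d p0
    push_cast at r1 ⊢
    change _ * lagQ α (n + 3) = _ * lagQ α (n + 2) - _ at r1
    change _ * (_ * derivative (lagQ α (n + 2))) =
      _ * (_ * lagQ α (n + 3) - _ * lagQ α (n + 2) - lagP α (n + 2))
    linear_combination X * d + (2 * (n : ℝ[X]) + 3 + C α - X) * h1
      - ((n : ℝ[X]) + 1 + C α) * h0 - ((n : ℝ[X]) + 2) * r1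
      + ((n : ℝ[X]) + 1) * r0 + p0

open Polynomial in
lemma lagP_ode (α : ℝ) (n : ℕ) :
    X * derivative (derivative (lagP α n)) + (C α + 1 - X) * derivative (lagP α n)
      + (n : ℝ[X]) * lagP α n = 0 := by
  obtain ⟨h0, h1⟩ := lagP_struct α n
  have r0 := lagSeq_rec α 1 (C α + 1 - X) n
  simp only [lagP_fold] at r0
  have d := congrArg derivative h0
  simp only [derivative_mul, derivative_add, derivative_sub, derivative_natCast, derivative_C,
    derivative_X, derivative_one] at d
  apply mul_left_cancel₀ (X_ne_zero (R := ℝ))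
  linear_combination X * d + ((n : ℝ[X]) + 1) * h1 + ((n : ℝ[X]) + 1) * r0
    - ((n : ℝ[X]) + 1) * h0

open Polynomial in
lemma lagQ_ode (α : ℝ) (n : ℕ) :
    X * derivative (derivative (lagQ α n)) + (X + 1 - C α) * derivative (lagQ α n)
      + ((n : ℝ[X]) + 1) * lagQ α n = - 2 * derivative (lagP α n) := by
  obtain ⟨h0, h1⟩ := lagQ_struct α n
  obtain ⟨g0, g1⟩ := lagP_struct α n
  have r0 := lagSeq_rec α 0 1 n
  simp only [lagQ_fold] at r0
  have d := congrArg derivative h0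
  simp only [derivative_mul, derivative_add, derivative_sub, derivative_natCast,
    derivative_X, derivative_one] at d
  apply mul_left_cancel₀ (X_ne_zero (R := ℝ))
  linear_combination X * d + ((n : ℝ[X]) + 1) * h1 + ((n : ℝ[X]) + 1) * r0
    + (X - C α - (n : ℝ[X]) - 1) * h0 + g0

open Polynomial in
/-- The inner operator applied to the co-recursive polynomial. -/
lemma inner_poly (α μ : ℝ) (n : ℕ) :
    X * derivative (derivative (lagP α n - C μ * lagQ α n))
      + (X + 1 - C α) * derivative (lagP α n - C μ * lagQ α n)
      + ((n : ℝ[X]) + 1) * (lagP α n - C μ * lagQ α n)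
      = lagP α n + (X - C α + C μ + (X - C α + C μ)) * derivative (lagP α n) := by
  have h := lagP_ode α n
  have g := lagQ_ode α n
  simp only [derivative_mul, derivative_sub, derivative_add, derivative_C, zero_mul, zero_add]
  linear_combination h - C μ * g

open Polynomial in
lemma iteratedDeriv_two_poly (p : ℝ[X]) (x : ℝ) :
    iteratedDeriv 2 (fun t => p.eval t) x = (derivative (derivative p)).eval x := by
  have h : ∀ q : ℝ[X], deriv (fun t => q.eval t) = fun t => (derivative q).eval t := by
    intro q; funext t; exact q.deriv
  rw [iteratedDeriv_succ, iteratedDeriv_one, h, h]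

theorem stmt11 (α μ : ℝ) (hα : -1 < α) (hα0 : α ≠ 0)
    (L : ℤ → ℝ → ℝ)
    (hinitm : ∀ x : ℝ, L (-1) x = μ / α)
    (hinit0 : ∀ x : ℝ, L 0 x = 1)
    (hrec : ∀ m : ℕ, ∀ x : ℝ,
      (2 * (m : ℝ) + α + 1 - x) * L (m : ℤ) x
        = ((m : ℝ) + 1) * L ((m : ℤ) + 1) x + ((m : ℝ) + α) * L ((m : ℤ) - 1) x)
    (n : ℕ) :
    ∀ x : ℝ,
      x * coefA α μ n x * iteratedDeriv 2 (innerOp α n (L (n : ℤ))) x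
        + ((2 + α - x) * coefA α μ n x - x * coefB α μ n x) *
            deriv (innerOp α n (L (n : ℤ))) x
        + (((n : ℝ) - 1) * coefA α μ n x + (x - α - 1) * coefB α μ n x + coefC α μ n x) *
            innerOp α n (L (n : ℤ)) x = 0 := by
  intro x
  have key : ∀ m : ℕ, (∀ t, L (m : ℤ) t = (lagP α m - Polynomial.C μ * lagQ α m).eval t) ∧
      (∀ t, L ((m : ℤ) + 1) t
        = (lagP α (m + 1) - Polynomial.C μ * lagQ α (m + 1)).eval t) := by
    intro m
    induction m with
    | zero =>
      refine ⟨fun t => by simp [hinit0, lagP, lagQ, lagSeq], fun t => ?_⟩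
      have h := hrec 0 t
      simp only [Nat.cast_zero, zero_sub, hinitm, hinit0] at h
      have e : (0 + α) * (μ / α) = μ := by field_simp; ring
      rw [e] at h
      simp [lagP, lagQ, lagSeq] at h ⊢
      linarith
    | succ m ih =>
      obtain ⟨h0, h1⟩ := ih
      refine ⟨fun t => by push_cast; exact h1 t, fun t => ?_⟩
      have h := hrec (m + 1) t
      push_cast at h ⊢
      rw [add_sub_cancel_right, h0, h1] at h
      have p := congrArg (Polynomial.eval t) (lagSeq_rec α 1 (Polynomial.C α + 1 - Polynomial.X) m)
      have q := congrArg (Polynomial.eval t) (lagSeq_rec α 0 1 m)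
      simp only [lagP_fold, lagQ_fold] at p q
      simp at p q h ⊢
      have hm : ((m : ℝ) + 2) ≠ 0 := by positivity
      apply mul_left_cancel₀ hm
      change _ = _ * (Polynomial.eval t (lagP α (m + 2)) - μ * Polynomial.eval t (lagQ α (m + 2)))
      linear_combination -h - p + μ * q
  have hL : L (n : ℤ) = fun t => (lagP α n - Polynomial.C μ * lagQ α n).eval t :=
    funext (key n).1
  have hin : innerOp α n (L (n : ℤ)) = fun t => (lagP α n + (Polynomial.X - Polynomial.C α
      + Polynomial.C μ + (Polynomial.X - Polynomial.C α + Polynomial.C μ)) * Polynomial.derivative (lagP α n)).eval t := by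
    funext t
    rw [← inner_poly, innerOp, hL, iteratedDeriv_two_poly, Polynomial.deriv]
    simp only [Polynomial.eval_add, Polynomial.eval_mul, Polynomial.eval_sub, Polynomial.eval_X,
      Polynomial.eval_C, Polynomial.eval_one, Polynomial.eval_natCast]
  rw [hin, iteratedDeriv_two_poly, Polynomial.deriv]
  have o := lagP_ode α n
  have o' := congrArg Polynomial.derivative o
  replace o := congrArg (Polynomial.eval x) o
  replace o' := congrArg (Polynomial.eval x) o'
  simp only [Polynomial.derivative_mul, Polynomial.derivative_add, Polynomial.derivative_sub,
    Polynomial.derivative_natCast, Polynomial.derivative_C, Polynomial.derivative_X,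
    Polynomial.derivative_one, Polynomial.derivative_zero,
    Polynomial.eval_add, Polynomial.eval_mul, Polynomial.eval_sub, Polynomial.eval_X,
    Polynomial.eval_C, Polynomial.eval_one, Polynomial.eval_natCast, Polynomial.eval_zero] at o o' ⊢
  generalize Polynomial.eval x (Polynomial.derivative (Polynomial.derivative
    (Polynomial.derivative (lagP α n)))) = p3 at *
  generalize Polynomial.eval x (Polynomial.derivative (Polynomial.derivative (lagP α n))) = p2 at *
  generalize Polynomial.eval x (Polynomial.derivative (lagP α n)) = p1 at *
  generalize Polynomial.eval x (lagP α n) = p0 at *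
  simp only [coefA, coefB, coefC]
  linear_combination (2 * (x - α + μ) * (3 * x + 2 * (x - α + μ) * (2 * (n : ℝ) * (x - α + μ) + x - α - 1))) * o'
    + (5 * (3 * x + 2 * (x - α + μ) * (2 * (n : ℝ) * (x - α + μ) + x - α - 1)) - 2 * (x - α + μ) * (1 + 2 * x - 2 * α + 2 * (1 + 4 * (n : ℝ)) * (x - α + μ))) * o
end
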